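/- arXiv:2301.11405 — 3 statements merged into one kernel-verified Lean document; each statement's English description precedes it below -/
import Mathlib

section
/- Let M and K be positive integers, λ ≥ 0, u ∈ Δ^K, σ_1,…,σ_M ∈ Δ^K, and y_1,…,y_M ∈ Δ^K with y_i^k > 0 for all i,k. Then for any choice of distributions S^1,…,S^K ∈ Δ^M with S_i^k > 0 for all i,k, the following upper bound holds: (1/M)·Σ_{i=1}^M H(σ_i, y_i) − λ·Σ_{k=1}^K u^k · ln((1/M)·Σ_{i=1}^M y_i^k) ≤ (1/M)·Σ_{i=1}^M H(σ_i, y_i) − λ·Σ_{k=1}^K Σ_{i=1}^M u^k · S_i^k · ln(y_i^k/(S_i^k · M)). -/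
/-- Jensen's inequality for `Real.log`, with the weights divided out of the arguments. -/
theorem sum_mul_log_div_le_log_sum {ι : Type*} (t : Finset ι) {w a : ι → ℝ}
    (hw : ∀ i ∈ t, 0 < w i) (hw1 : ∑ i ∈ t, w i = 1) (ha : ∀ i ∈ t, 0 < a i) :
    ∑ i ∈ t, w i * Real.log (a i / w i) ≤ Real.log (∑ i ∈ t, a i) := by
  have h := strictConcaveOn_log_Ioi.concaveOn.le_map_sum (t := t) (w := w)
    (p := fun i => a i / w i) (fun i hi => (hw i hi).le) hw1
    (fun i hi => div_pos (ha i hi) (hw i hi))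
  simp only [smul_eq_mul] at h
  rwa [Finset.sum_congr rfl fun i hi => mul_div_cancel₀ (a i) (hw i hi).ne'] at h

/-- Jensen upper bound on the self-labeling loss: for any positive
normalized cluster supports `S^k ∈ Δ^M`, the loss
`(1/M)·Σ_i H(σ_i,y_i) − λ·Σ_k u^k·ln((1/M)·Σ_i y_i^k)` is bounded above by the EM surrogate
`(1/M)·Σ_i H(σ_i,y_i) − λ·Σ_k Σ_i u^k·S_i^k·ln(y_i^k/(S_i^k·M))`. -/
theorem em_surrogate_upper_bound
    (M K : ℕ) (hM : 0 < M) (hK : 0 < K)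
    (lam : ℝ) (hlam : 0 ≤ lam)
    (u : Fin K → ℝ) (hu0 : ∀ k, 0 ≤ u k) (hu1 : ∑ k, u k = 1)
    (σ : Fin M → Fin K → ℝ) (hσ0 : ∀ i k, 0 ≤ σ i k) (hσ1 : ∀ i, ∑ k, σ i k = 1)
    (y : Fin M → Fin K → ℝ) (hy0 : ∀ i k, 0 < y i k) (hy1 : ∀ i, ∑ k, y i k = 1)
    (S : Fin K → Fin M → ℝ) (hS0 : ∀ k i, 0 < S k i) (hS1 : ∀ k, ∑ i, S k i = 1)
    (H : (Fin K → ℝ) → (Fin K → ℝ) → ℝ)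
    (hH : ∀ p q, H p q = -∑ k, p k * Real.log (q k)) :
    (1 / M : ℝ) * ∑ i, H (σ i) (y i)
        - lam * ∑ k, u k * Real.log ((1 / M : ℝ) * ∑ i, y i k)
      ≤ (1 / M : ℝ) * ∑ i, H (σ i) (y i)
        - lam * ∑ k, ∑ i, u k * S k i * Real.log (y i k / (S k i * M)) := by
  have hM' : (0 : ℝ) < M := Nat.cast_pos.mpr hM
  gcongr with k _
  have hJensen := sum_mul_log_div_le_log_sum Finset.univ (w := S k) (a := fun i => y i k / M)
    (fun i _ => hS0 k i) (hS1 k) (fun i _ => div_pos (hy0 i k) hM')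
  calc ∑ i, u k * S k i * Real.log (y i k / (S k i * M))
      = u k * ∑ i, S k i * Real.log (y i k / M / S k i) := by
        simp only [Finset.mul_sum, mul_assoc, div_div, mul_comm (S k _) (M : ℝ)]
    _ ≤ u k * Real.log (∑ i, y i k / M) := mul_le_mul_of_nonneg_left hJensen (hu0 k)
    _ = u k * Real.log ((1 / M : ℝ) * ∑ i, y i k) := by
        rw [← Finset.sum_div, one_div_mul_eq_div]
end

section
/- Let K and M be positive integers, λ > 0, σ ∈ Δ^K with σ^k > 0 for all k, u ∈ Δ^K, and s ∈ ℝ^K with s^k ≥ 0 for all k. Define a^k = σ^k + λ·M·u^k·s^k and Z = 1 + λ·M·Σ_{c=1}^K u^c·s^c. Then Σ_{k=1}^K a^k = Z, the vector y* with components y*^k = a^k/Z lies in Δ^K with all components positive, and y* is the unique minimizer of g(y) = −Σ_{k=1}^K a^k · ln(y^k) over the set of y ∈ Δ^K with y^k > 0 for all k. -/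
/-- Strict Gibbs inequality for positive weights of equal total mass. -/
theorem sum_mul_log_lt_sum_mul_log_self {ι : Type*} [Fintype ι] {p q : ι → ℝ}
    (hp : ∀ i, 0 < p i) (hq : ∀ i, 0 < q i) (hpq : ∑ i, q i = ∑ i, p i) (hne : q ≠ p) :
    ∑ i, p i * Real.log (q i) < ∑ i, p i * Real.log (p i) := by
  have log_div (i : ι) : Real.log (q i / p i) = Real.log (q i) - Real.log (p i) :=
    Real.log_div (hq i).ne' (hp i).ne'
  have mul_sub_one (i : ι) : p i * (q i / p i - 1) = q i - p i := by
    have := (hp i).ne'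
    field_simp
  obtain ⟨j, hj⟩ := Function.ne_iff.mp hne
  have hlt : ∑ i, p i * (Real.log (q i) - Real.log (p i)) < ∑ i, (q i - p i) := by
    refine Finset.sum_lt_sum (fun i _ => ?_) ⟨j, Finset.mem_univ j, ?_⟩
    · rw [← log_div, ← mul_sub_one]
      exact mul_le_mul_of_nonneg_left
        (Real.log_le_sub_one_of_pos (div_pos (hq i) (hp i))) (hp i).le
    · rw [← log_div, ← mul_sub_one]
      refine mul_lt_mul_of_pos_left
        (Real.log_lt_sub_one_of_pos (div_pos (hq j) (hp j)) fun h => hj ?_) (hp j)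
      exact (div_eq_one_iff_eq (hp j).ne').mp h
  simp only [mul_sub, Finset.sum_sub_distrib] at hlt
  linarith


/-- Closed-form M-step. With `a^k = σ^k + λM·u^k·s^k` and
`Z = 1 + λM·Σ_c u^c·s^c`, one has `Σ_k a^k = Z`, the vector `y*^k = a^k/Z` lies in the
positive part of `Δ^K`, and it is the unique minimizer of `g(y) = −Σ_k a^k·ln(y^k)`
over positive points of `Δ^K`. -/
theorem m_step_closed_form
    (K M : ℕ) (hK : 0 < K) (hM : 0 < M)
    (lam : ℝ) (hlam : 0 < lam)
    (σ : Fin K → ℝ) (hσ0 : ∀ k, 0 < σ k) (hσ1 : ∑ k, σ k = 1)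
    (u : Fin K → ℝ) (hu0 : ∀ k, 0 ≤ u k) (hu1 : ∑ k, u k = 1)
    (s : Fin K → ℝ) (hs : ∀ k, 0 ≤ s k)
    (a : Fin K → ℝ) (ha : ∀ k, a k = σ k + lam * M * u k * s k)
    (Z : ℝ) (hZ : Z = 1 + lam * M * ∑ c, u c * s c)
    (g : (Fin K → ℝ) → ℝ) (hg : ∀ y, g y = -∑ k, a k * Real.log (y k)) :
    (∑ k, a k = Z) ∧
    (∀ k, 0 < a k / Z) ∧
    (∑ k, a k / Z = 1) ∧
    (∀ y : Fin K → ℝ, (∀ k, 0 < y k) → (∑ k, y k = 1) →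
      y ≠ (fun k => a k / Z) → g (fun k => a k / Z) < g y) := by
  have ha_pos (k : Fin K) : 0 < a k := by
    rw [ha]
    have := hσ0 k
    have := hu0 k
    have := hs k
    positivity
  have hsum : ∑ k, a k = Z := by
    simp only [ha, hZ, Finset.sum_add_distrib, hσ1, Finset.mul_sum, mul_assoc]
  have hZ_pos : 0 < Z := by
    rw [← hsum]
    exact Finset.sum_pos (fun k _ => ha_pos k) ⟨⟨0, hK⟩, Finset.mem_univ _⟩
  have hstar_pos (k : Fin K) : 0 < a k / Z := div_pos (ha_pos k) hZ_pos
  have hstar_sum : ∑ k, a k / Z = 1 := by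
    rw [← Finset.sum_div, hsum, div_self hZ_pos.ne']
  refine ⟨hsum, hstar_pos, hstar_sum, fun y hy hy1 hne => ?_⟩
  have hgibbs := sum_mul_log_lt_sum_mul_log_self hstar_pos hy (hy1.trans hstar_sum.symm) hne
  simp only [div_mul_eq_mul_div, ← Finset.sum_div] at hgibbs
  rw [hg, hg]
  exact neg_lt_neg ((div_lt_div_iff_of_pos_right hZ_pos).mp hgibbs)
end

section
/- Let M and K be positive integers, λ > 0, u ∈ Δ^K with u^k > 0 for all k, σ_1,…,σ_M ∈ Δ^K with σ_i^k > 0 for all i,k, and y_1,…,y_M ∈ Δ^K with y_i^k > 0 for all i,k. Define the E-step S_i^k = y_i^k / Σ_{j=1}^M y_j^k and then the M-step y'_i^k = (σ_i^k + λ·M·u^k·S_i^k)/(1 + λ·M·Σ_{c=1}^K u^c·S_i^c). Then the objective does not increase: F(y') ≤ F(y), where F(y) = (1/M)·Σ_{i=1}^M H(σ_i, y_i) + λ·H(u, ȳ) and ȳ = (1/M)·Σ_{i=1}^M y_i. -/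
/-- The log-sum inequality for positive families. -/
theorem log_sum_inequality {ι : Type*} [Fintype ι] [Nonempty ι] {a b : ι → ℝ}
    (ha : ∀ i, 0 < a i) (hb : ∀ i, 0 < b i) :
    ∑ i, a i * (Real.log (b i) - Real.log (a i)) ≤
      (∑ i, a i) * (Real.log (∑ i, b i) - Real.log (∑ i, a i)) := by
  have hA : 0 < ∑ i, a i := Finset.sum_pos (fun i _ => ha i) Finset.univ_nonempty
  have hB : 0 < ∑ i, b i := Finset.sum_pos (fun i _ => hb i) Finset.univ_nonempty
  set A := ∑ i, a i with hAdef
  set B := ∑ i, b i with hBdef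
  have key : ∀ i, a i * (Real.log (b i) - Real.log (a i)) ≤
      a i * (Real.log B - Real.log A) + (b i * (A / B) - a i) := by
    intro i
    have hai := ha i
    have hbi := hb i
    have h := Real.log_le_sub_one_of_pos (x := b i * A / (a i * B)) (by positivity)
    rw [Real.log_div (by positivity) (by positivity), Real.log_mul hbi.ne' hA.ne',
      Real.log_mul hai.ne' hB.ne'] at h
    have h' := mul_le_mul_of_nonneg_left h hai.le
    have e : a i * (b i * A / (a i * B) - 1) = b i * (A / B) - a i := by field_simp
    linarith
  calc _ ≤ ∑ i, (a i * (Real.log B - Real.log A) + (b i * (A / B) - a i)) :=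
        Finset.sum_le_sum fun i _ => key i
    _ = A * (Real.log B - Real.log A) := by
        rw [Finset.sum_add_distrib, Finset.sum_sub_distrib, ← Finset.sum_mul, ← Finset.sum_mul,
          ← hAdef, ← hBdef, mul_div_cancel₀ A hB.ne', sub_self, add_zero]

/-- The Gibbs inequality: normalizing positive weights maximizes the weighted log-likelihood. -/
theorem sum_mul_log_normalize_sub_log_nonneg {ι : Type*} [Fintype ι] [Nonempty ι] {w y : ι → ℝ}
    (hw : ∀ k, 0 < w k) (hy : ∀ k, 0 < y k) (hy1 : ∑ k, y k = 1) :
    0 ≤ ∑ k, w k * (Real.log (w k / ∑ c, w c) - Real.log (y k)) := by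
  have hW : 0 < ∑ k, w k := Finset.sum_pos (fun k _ => hw k) Finset.univ_nonempty
  have h := log_sum_inequality hw hy
  rw [hy1, Real.log_one] at h
  have e : ∑ k, w k * (Real.log (w k / ∑ c, w c) - Real.log (y k)) =
      -(∑ k, w k * (Real.log (y k) - Real.log (w k))) - (∑ k, w k) * Real.log (∑ c, w c) := by
    rw [Finset.sum_mul, ← Finset.sum_neg_distrib, ← Finset.sum_sub_distrib]
    refine Finset.sum_congr rfl fun k _ => ?_
    rw [Real.log_div (hw k).ne' hW.ne']
    ring
  linarith

/-- The Jensen inequality for the E-step minorant of the logarithm of a sum. -/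
theorem sum_responsibility_mul_log_sub_log_le {ι : Type*} [Fintype ι] [Nonempty ι] {y z : ι → ℝ}
    (hy : ∀ i, 0 < y i) (hz : ∀ i, 0 < z i) :
    ∑ i, y i / (∑ j, y j) * (Real.log (z i) - Real.log (y i)) ≤
      Real.log (∑ i, z i) - Real.log (∑ i, y i) := by
  have hT : 0 < ∑ i, y i := Finset.sum_pos (fun i _ => hy i) Finset.univ_nonempty
  have h := log_sum_inequality hy hz
  simp_rw [div_mul_eq_mul_div]
  rw [← Finset.sum_div, div_le_iff₀ hT]
  linarith


/-- One full EM iteration (E-step `S_i^k = y_i^k/Σ_j y_j^k`, then M-step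
`y'_i^k = (σ_i^k + λM·u^k·S_i^k)/(1 + λM·Σ_c u^c·S_i^c)`) does not increase the objective
`F(y) = (1/M)·Σ_i H(σ_i,y_i) + λ·H(u,ȳ)` with `ȳ = (1/M)·Σ_i y_i`. -/
theorem em_iteration_descent
    (M K : ℕ) (hM : 0 < M) (hK : 0 < K)
    (lam : ℝ) (hlam : 0 < lam)
    (u : Fin K → ℝ) (hu0 : ∀ k, 0 < u k) (hu1 : ∑ k, u k = 1)
    (σ : Fin M → Fin K → ℝ) (hσ0 : ∀ i k, 0 < σ i k) (hσ1 : ∀ i, ∑ k, σ i k = 1)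
    (y : Fin M → Fin K → ℝ) (hy0 : ∀ i k, 0 < y i k) (hy1 : ∀ i, ∑ k, y i k = 1)
    (S : Fin M → Fin K → ℝ) (hS : ∀ i k, S i k = y i k / ∑ j, y j k)
    (y' : Fin M → Fin K → ℝ)
    (hy' : ∀ i k, y' i k =
      (σ i k + lam * M * u k * S i k) / (1 + lam * M * ∑ c, u c * S i c))
    (F : (Fin M → Fin K → ℝ) → ℝ)
    (hF : ∀ z, F z = (1 / M : ℝ) * ∑ i, (-∑ k, σ i k * Real.log (z i k))
        + lam * (-∑ k, u k * Real.log ((1 / M : ℝ) * ∑ i, z i k))) :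
    F y' ≤ F y := by
  have : Nonempty (Fin M) := ⟨⟨0, hM⟩⟩
  have : Nonempty (Fin K) := ⟨⟨0, hK⟩⟩
  have hM0 : (0 : ℝ) < M := by exact_mod_cast hM
  have hT : ∀ {z : Fin M → Fin K → ℝ}, (∀ i k, 0 < z i k) → ∀ k, 0 < ∑ j, z j k :=
    fun hz k => Finset.sum_pos (fun j _ => hz j k) Finset.univ_nonempty
  have hS0 : ∀ i k, 0 < S i k := fun i k => by
    rw [hS]
    exact div_pos (hy0 i k) (hT hy0 k)
  have hw0 : ∀ i k, 0 < σ i k + lam * M * u k * S i k := fun i k => by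
    have := hσ0 i k
    have := hu0 k
    have := hS0 i k
    positivity
  have hW : ∀ i, ∑ k, (σ i k + lam * M * u k * S i k) = 1 + lam * M * ∑ c, u c * S i c := by
    intro i
    rw [Finset.sum_add_distrib, hσ1, Finset.mul_sum]
    simp only [mul_assoc]
  have hy'0 : ∀ i k, 0 < y' i k := fun i k => by
    rw [hy', ← hW]
    exact div_pos (hw0 i k) (Finset.sum_pos (fun c _ => hw0 i c) Finset.univ_nonempty)
  have gibbs : 0 ≤ ∑ i, ∑ k, (σ i k + lam * M * u k * S i k) *
      (Real.log (y' i k) - Real.log (y i k)) := by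
    refine Finset.sum_nonneg fun i _ => ?_
    have h := sum_mul_log_normalize_sub_log_nonneg (hw0 i) (hy0 i) (hy1 i)
    rw [hW] at h
    simpa only [← hy'] using h
  have jensen : ∑ k, u k * ∑ i, S i k * (Real.log (y' i k) - Real.log (y i k)) ≤
      ∑ k, u k * (Real.log (∑ i, y' i k) - Real.log (∑ i, y i k)) := by
    refine Finset.sum_le_sum fun k _ => mul_le_mul_of_nonneg_left ?_ (hu0 k).le
    simpa only [← hS] using
      sum_responsibility_mul_log_sub_log_le (fun i => hy0 i k) (fun i => hy'0 i k)
  have split : ∑ i, ∑ k, (σ i k + lam * M * u k * S i k) *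
      (Real.log (y' i k) - Real.log (y i k)) =
      ∑ i, ∑ k, σ i k * (Real.log (y' i k) - Real.log (y i k)) +
      lam * M * ∑ k, u k * ∑ i, S i k * (Real.log (y' i k) - Real.log (y i k)) := by
    simp only [add_mul, Finset.sum_add_distrib, Finset.mul_sum]
    congr 1
    rw [Finset.sum_comm]
    refine Finset.sum_congr rfl fun k _ => Finset.sum_congr rfl fun i _ => ?_
    ring
  have hlog : ∀ {z : Fin M → Fin K → ℝ}, (∀ i k, 0 < z i k) → ∀ k,
      Real.log ((1 / M : ℝ) * ∑ i, z i k) = Real.log (1 / M : ℝ) + Real.log (∑ i, z i k) :=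
    fun hz k => Real.log_mul (by positivity) (hT hz k).ne'
  have diff : F y - F y' =
      (1 / M : ℝ) * ∑ i, ∑ k, σ i k * (Real.log (y' i k) - Real.log (y i k)) +
      lam * ∑ k, u k * (Real.log (∑ i, y' i k) - Real.log (∑ i, y i k)) := by
    simp only [hF, hlog hy0, hlog hy'0, mul_add, mul_sub, Finset.sum_add_distrib,
      Finset.sum_sub_distrib, Finset.sum_neg_distrib]
    ring
  have scale : (M : ℝ) * (F y - F y') =
      ∑ i, ∑ k, σ i k * (Real.log (y' i k) - Real.log (y i k)) +
      lam * M * ∑ k, u k * (Real.log (∑ i, y' i k) - Real.log (∑ i, y i k)) := by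
    rw [diff]
    field_simp
  have hmono := mul_le_mul_of_nonneg_left jensen (mul_pos hlam hM0).le
  have hnonneg : 0 ≤ (M : ℝ) * (F y - F y') := by linarith
  exact sub_nonneg.mp (nonneg_of_mul_nonneg_right hnonneg hM0)
end
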